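/- Let μ be an ergodic shift-invariant probability measure on X = A^ℕ. Then for every q ∈ ℝ one has q·h(μ) ≤ liminf_{n→∞} (1/n) log ∫ R_n(x)^q dμ(x). -/

import Mathlib

open MeasureTheory Filter Topology Set

namespace RTSpec

variable (A : Type*) [Fintype A] [TopologicalSpace A] [DiscreteTopology A]
  [MeasurableSpace A] [BorelSpace A]

/-- The sequence space `X = A^ℕ` (0-indexed: `x 0` is the paper's `x₁`). -/
abbrev X := ℕ → A

/-- The shift map `θ`. -/
def shift : X A → X A := fun x n => x (n + 1)

/-- The cylinder `[a_1^n]` based on the word `w = a_1^n`. -/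
def cyl {n : ℕ} (w : Fin n → A) : Set (X A) := {x | ∀ i : Fin n, x i.val = w i}

/-- Return time `R_n(x) = inf {k ≥ 2 : x_k^{k+n-1} = x_1^n}` (with `sInf ∅ = 0`). -/
noncomputable def retTime (n : ℕ) (x : X A) : ℕ := sInf {k | 2 ≤ k ∧ ∀ i < n, x (k - 1 + i) = x i}

/-- Hitting time `T_{a_1^n}(y) = inf {k ≥ 1 : y_k^{k+n-1} = a_1^n}`. -/
noncomputable def hitTime {n : ℕ} (w : Fin n → A) (y : X A) : ℕ :=
  sInf {k | 1 ≤ k ∧ ∀ i : Fin n, y (k - 1 + i.val) = w i}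

/-- Hitting/return time in the shifted sense: `inf {k ≥ 1 : θ^k y ∈ [a_1^n]}`. -/
noncomputable def hitTime' {n : ℕ} (w : Fin n → A) (y : X A) : ℕ :=
  sInf {k | 1 ≤ k ∧ ∀ i : Fin n, y (k + i.val) = w i}

/-- `τ(a_1^n) = inf {k ≥ 1 : [a_1^n] ∩ θ^{-k}[a_1^n] ≠ ∅}`, the smallest return time
of the cylinder `[a_1^n]`. -/
noncomputable def tau {n : ℕ} (w : Fin n → A) : ℕ :=
  sInf {k | 1 ≤ k ∧ (cyl A w ∩ {y | ∀ i : Fin n, y (k + i.val) = w i}).Nonempty}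

/-- `ζ_μ(a_1^n) = μ([a_1^n] ∩ {T_{a_1^n} ≠ τ(a_1^n)}) / μ([a_1^n])`. -/
noncomputable def zeta (μ : Measure (X A)) {n : ℕ} (w : Fin n → A) : ℝ :=
  (μ (cyl A w ∩ {y | hitTime' A w y ≠ tau A w})).toReal / (μ (cyl A w)).toReal

/-- A shift-invariant Borel probability measure. -/
def InvProb (η : Measure (X A)) : Prop :=
  IsProbabilityMeasure η ∧ Measure.map (shift A) η = η

/-- The `n`-th term `-(1/n) Σ_{a_1^n} μ(a_1^n) log μ(a_1^n)` of the entropy sequence. -/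
noncomputable def entSeq (μ : Measure (X A)) (n : ℕ) : ℝ :=
  -(1 / (n : ℝ)) * ∑ w : Fin n → A, (μ (cyl A w)).toReal * Real.log (μ (cyl A w)).toReal

/-- The entropy `h(μ)`, i.e. the limit of `entSeq` (which always exists for a
shift-invariant measure; we realize it as a liminf). -/
noncomputable def entropy (μ : Measure (X A)) : ℝ := atTop.liminf (entSeq A μ)

/-- Topological pressure `P(ψ) = sup_η {h(η) + ∫ ψ dη}`, the supremum running over
all shift-invariant probability measures. -/
noncomputable def pressure (ψ : X A → ℝ) : ℝ :=
  sSup {r | ∃ η : Measure (X A), InvProb A η ∧ r = entropy A η + ∫ x, ψ x ∂η}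

/-- `sup_η ∫ φ dη` over shift-invariant probability measures. -/
noncomputable def supInt (φ : X A → ℝ) : ℝ :=
  sSup {r | ∃ η : Measure (X A), InvProb A η ∧ r = ∫ x, φ x ∂η}

/-- `inf_η ∫ φ dη` over shift-invariant probability measures. -/
noncomputable def infInt (φ : X A → ℝ) : ℝ :=
  sInf {r | ∃ η : Measure (X A), InvProb A η ∧ r = ∫ x, φ x ∂η}

/-- `var_n(φ) = sup {|φ(x) - φ(y)| : x_1^n = y_1^n}`. -/
noncomputable def Var (φ : X A → ℝ) (n : ℕ) : ℝ :=
  sSup {r | ∃ x y : X A, (∀ i < n, x i = y i) ∧ r = |φ x - φ y|}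

/-- Prepending a symbol: `ax = (a, x_1, x_2, …)`. -/
def prepend (a : A) (x : X A) : X A := fun n => Nat.casesOn n a x

/-- A potential `φ` is normalized if `Σ_{a ∈ A} e^{φ(ax)} = 1` for all `x`. -/
def Normalized (φ : X A → ℝ) : Prop :=
  ∀ x : X A, ∑ a : A, Real.exp (φ (prepend A a x)) = 1

/-- `μ` is an equilibrium state for `φ`: a probability measure fixed by the dual
transfer operator, i.e. `∫ L_φ f dμ = ∫ f dμ` for every continuous `f`. -/
def IsEqSt (φ : X A → ℝ) (μ : Measure (X A)) : Prop :=
  IsProbabilityMeasure μ ∧ ∀ f : X A → ℝ, Continuous f →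
    ∫ x, (∑ a : A, Real.exp (φ (prepend A a x)) * f (prepend A a x)) ∂μ = ∫ x, f x ∂μ

/-- The `n`-th term `(1/n) log ∫ R_n^q dμ` of the return-time `L^q`-spectrum,
with values in `EReal` (the integral may be infinite). -/
noncomputable def RSeq (μ : Measure (X A)) (q : ℝ) (n : ℕ) : EReal :=
  (((n : ℝ)⁻¹ : ℝ) : EReal) *
    ENNReal.log (∫⁻ x, ENNReal.ofReal ((retTime A n x : ℝ) ^ q) ∂μ)

/-- The `n`-th term `(1/n) log Σ_{a_1^n} μ(a_1^n)^{1-q}` of the `L^q`-spectrum of `μ`. -/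
noncomputable def MSeq (μ : Measure (X A)) (q : ℝ) (n : ℕ) : ℝ :=
  (1 / (n : ℝ)) * Real.log (∑ w : Fin n → A, (μ (cyl A w)).toReal ^ (1 - q))

/-- `Λ^{(n)}(μ) = (1/n) log Σ_{a_1^n} (1 - ζ_μ(a_1^n)) μ(a_1^n)`. -/
noncomputable def LamSeq (μ : Measure (X A)) (n : ℕ) : ℝ :=
  (1 / (n : ℝ)) * Real.log (∑ w : Fin n → A, (1 - zeta A μ w) * (μ (cyl A w)).toReal)

/-- `(1/n) log max_{a_1^n} μ(a_1^n)`. -/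
noncomputable def gammaSeq (μ : Measure (X A)) (n : ℕ) : ℝ :=
  (1 / (n : ℝ)) * Real.log (⨆ w : Fin n → A, (μ (cyl A w)).toReal)

/-- `μ` is φ-mixing with rate `ϕ`: `ϕ` decreases to `0` and for all `n, ℓ ≥ 1`,
all `S` in the σ-algebra generated by coordinates `1, …, n` with `μ S ≠ 0`, and
all `T` in the σ-algebra generated by coordinates `n+ℓ, n+ℓ+1, …`,
`|μ(S ∩ T)/μ(S) - μ(T)| ≤ ϕ(ℓ)`. -/
def PhiMixing (μ : Measure (X A)) (ϕ : ℕ → ℝ) : Prop :=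
  (∀ ℓ, 0 < ϕ ℓ) ∧ Antitone ϕ ∧ Tendsto ϕ atTop (nhds 0) ∧
  ∀ n ℓ : ℕ, 1 ≤ n → 1 ≤ ℓ →
    ∀ S T : Set (X A),
      MeasurableSet[MeasurableSpace.comap
        (fun x : X A => fun i : Fin n => x i.val) inferInstance] S →
      MeasurableSet[MeasurableSpace.comap
        (fun x : X A => fun j : ℕ => x (n + ℓ - 1 + j)) inferInstance] T →
      μ S ≠ 0 →
      |(μ (S ∩ T)).toReal / (μ S).toReal - (μ T).toReal| ≤ ϕ ℓ

set_option linter.unusedSectionVars false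

/-- Gibbs' inequality for a conditional law: the conditional entropy of the first coordinate of
`p` given the second is at most the mean code length of any conditional sub-probability `Q`. -/
lemma condEntropy_le_codeLength {U V : Type*} [Fintype U] [Fintype V] (p Q : U → V → ℝ)
    (hp : ∀ u v, 0 ≤ p u v) (hQ : ∀ u v, 0 < Q u v) (hQ1 : ∀ v, ∑ u, Q u v ≤ 1) :
    ∑ v, (∑ u, p u v) * Real.log (∑ u, p u v) - ∑ v, ∑ u, p u v * Real.log (p u v)
      ≤ ∑ v, ∑ u, p u v * -Real.log (Q u v) := by
  have key : ∀ v u, p u v * Real.log (∑ u', p u' v) - p u v * Real.log (p u v)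
      - p u v * -Real.log (Q u v) ≤ (∑ u', p u' v) * Q u v - p u v := by
    intro v u
    have hle : p u v ≤ ∑ u', p u' v :=
      Finset.single_le_sum (f := fun u' => p u' v) (fun i _ => hp i v) (Finset.mem_univ u)
    rcases (hp u v).eq_or_lt with h0 | h0
    · rw [← h0]
      have := mul_nonneg (Finset.sum_nonneg fun i (_ : i ∈ Finset.univ) => hp i v) (hQ u v).le
      simpa using this
    · have hs : 0 < ∑ u', p u' v := h0.trans_le hle
      have hlog := Real.log_le_sub_one_of_pos (div_pos (mul_pos hs (hQ u v)) h0)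
      rw [Real.log_div (mul_pos hs (hQ u v)).ne' h0.ne', Real.log_mul hs.ne' (hQ u v).ne'] at hlog
      have := mul_le_mul_of_nonneg_left hlog h0.le
      rw [mul_sub, mul_sub, mul_div_cancel₀ _ h0.ne'] at this
      linarith
  have hsum : ∑ v, ∑ u, (p u v * Real.log (∑ u', p u' v) - p u v * Real.log (p u v)
      - p u v * -Real.log (Q u v)) ≤ 0 := by
    refine Finset.sum_nonpos fun v _ => (Finset.sum_le_sum fun u _ => key v u).trans ?_
    rw [Finset.sum_sub_distrib, ← Finset.mul_sum]
    have := mul_le_mul_of_nonneg_left (hQ1 v)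
      (Finset.sum_nonneg fun i (_ : i ∈ Finset.univ) => hp i v)
    linarith
  simp only [Finset.sum_sub_distrib, ← Finset.sum_mul] at hsum
  linarith

/-- If `H N / N → h`, the increments of `H` over steps of length `n` are infinitely often
at least `n * (h - ε)`. -/
lemma exists_increment_ge {H : ℕ → ℝ} {h ε : ℝ} (hH : Tendsto (fun N : ℕ => H N / N) atTop (𝓝 h))
    (hε : 0 < ε) {n : ℕ} (hn : 1 ≤ n) (M : ℕ) : ∃ m ≥ M, n * (h - ε) ≤ H (n + m) - H m := by
  by_contra! hcon
  have hbound : ∀ j : ℕ, H (M + j * n) ≤ H M + j * n * (h - ε) := by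
    intro j
    induction j with
    | zero => simp
    | succ j ih =>
      have := hcon (M + j * n) (by omega)
      rw [show n + (M + j * n) = M + (j + 1) * n by ring] at this
      push_cast
      linarith
  have hidx : Tendsto (fun j : ℕ => M + j * n) atTop atTop :=
    tendsto_atTop_mono (fun j => (Nat.le_mul_of_pos_right j hn).trans (Nat.le_add_left _ _))
      tendsto_id
  have hlim : Tendsto (fun j : ℕ => (h - ε) + (H M - M * (h - ε)) / ((M + j * n : ℕ) : ℝ)) atTop
      (𝓝 ((h - ε) + 0)) :=
    tendsto_const_nhds.add
      ((tendsto_const_nhds.div_atTop tendsto_natCast_atTop_atTop).comp hidx)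
  have := le_of_tendsto_of_tendsto (hH.comp hidx) hlim (by
    filter_upwards [eventually_ge_atTop 1] with j hj
    have hpos : (0 : ℝ) < ((M + j * n : ℕ) : ℝ) := by
      have : 1 ≤ j * n := Nat.mul_pos hj hn
      exact_mod_cast (by omega : 0 < M + j * n)
    simp only [Function.comp]
    rw [div_le_iff₀ hpos, add_mul, div_mul_cancel₀ _ hpos.ne']
    have := hbound j
    push_cast
    linarith)
  linarith

lemma exp_sum_le_sum_exp {ι : Type*} [Fintype ι] (p y : ι → ℝ) (hp : ∀ i, 0 ≤ p i)
    (hp1 : ∑ i, p i = 1) : Real.exp (∑ i, p i * y i) ≤ ∑ i, p i * Real.exp (y i) := by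
  simpa using convexOn_exp.map_sum_le (t := Finset.univ) (w := p) (p := y)
    (fun i _ => hp i) hp1 (fun i _ => mem_univ _)

/-- Tangent line inequality for `t ↦ t ^ q` with `q ≤ 0`. -/
lemma rpow_tangent_le {q C t : ℝ} (hq : q ≤ 0) (hC : 0 < C) (ht : 0 < t) :
    (1 - q) * C ^ q ≤ t ^ q + -q * C ^ q / C * t := by
  have h1 : t ^ q = C ^ q * (t / C) ^ q := by
    rw [← Real.mul_rpow hC.le (div_pos ht hC).le, mul_div_cancel₀ _ hC.ne']
  have h2 : 1 + q * (t / C - 1) ≤ (t / C) ^ q := by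
    rw [Real.rpow_def_of_pos (div_pos ht hC)]
    have h3 := Real.add_one_le_exp (Real.log (t / C) * q)
    have h4 := mul_le_mul_of_nonpos_left (Real.log_le_sub_one_of_pos (div_pos ht hC)) hq
    linarith
  have h5 := mul_le_mul_of_nonneg_left h2 (Real.rpow_pos_of_pos hC q).le
  rw [h1]
  have h6 : -q * C ^ q / C * t = -(C ^ q * (q * (t / C))) := by ring
  rw [h6]
  linarith

lemma cyl_eq_preimage {n : ℕ} (w : Fin n → A) :
    cyl A w = (fun (x : X A) (i : Fin n) => x i) ⁻¹' {w} := by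
  ext x
  simp [cyl, funext_iff]

lemma measurableSet_cyl {n : ℕ} (w : Fin n → A) : MeasurableSet (cyl A w) := by
  have : cyl A w = ⋂ i : Fin n, (fun x : X A => x i) ⁻¹' {w i} := by
    ext x
    simp [cyl]
  rw [this]
  exact MeasurableSet.iInter fun i => measurable_pi_apply _ (measurableSet_singleton _)

lemma measurable_shift : Measurable (shift A) :=
  measurable_pi_lambda _ fun n => measurable_pi_apply (n + 1)

lemma iterate_shift_apply (k : ℕ) (x : X A) (i : ℕ) : (shift A)^[k] x i = x (k + i) := by
  induction k generalizing x with
  | zero => simp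
  | succ k ih =>
    rw [Function.iterate_succ_apply, ih]
    simp only [shift]
    congr 1
    omega

lemma sum_measure_inter_cyl (μ : Measure (X A)) (n : ℕ) (s : Set (X A)) :
    ∑ w : Fin n → A, μ (s ∩ cyl A w) = μ s := by
  have := sum_measure_preimage_singleton (μ := μ.restrict s) (Finset.univ : Finset (Fin n → A))
    (f := fun (x : X A) (i : Fin n) => x i)
    (fun w _ => by rw [← cyl_eq_preimage]; exact measurableSet_cyl A w)
  simp only [← cyl_eq_preimage, Finset.coe_univ, preimage_univ, Measure.restrict_apply_univ] at this
  rw [← this]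
  refine Finset.sum_congr rfl fun w _ => ?_
  rw [Measure.restrict_apply (measurableSet_cyl A w), inter_comm]

lemma sum_toReal_measure_inter_cyl (μ : Measure (X A)) [IsFiniteMeasure μ] (n : ℕ)
    (s : Set (X A)) : ∑ w : Fin n → A, (μ (s ∩ cyl A w)).toReal = (μ s).toReal := by
  rw [← ENNReal.toReal_sum fun _ _ => measure_ne_top _ _, sum_measure_inter_cyl]

lemma sum_toReal_measure_cyl (μ : Measure (X A)) [IsProbabilityMeasure μ] (n : ℕ) :
    ∑ w : Fin n → A, (μ (cyl A w)).toReal = 1 := by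
  simpa using sum_toReal_measure_inter_cyl A μ n univ

lemma sum_setLIntegral_cyl (μ : Measure (X A)) (n : ℕ) (f : X A → ENNReal) :
    ∑ w : Fin n → A, ∫⁻ x in cyl A w, f x ∂μ = ∫⁻ x, f x ∂μ := by
  have hU : ⋃ w : Fin n → A, cyl A w = univ :=
    eq_univ_of_forall fun x => mem_iUnion.2 ⟨fun i => x i, fun i => rfl⟩
  rw [← tsum_fintype (L := .unconditional _), ← lintegral_iUnion (measurableSet_cyl A), hU,
    setLIntegral_univ]
  intro v w hvw
  refine disjoint_left.2 fun x hv hw => hvw (funext fun i => ?_)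
  rw [← hv i, ← hw i]

/-- Summing over the first `n` letters of a word, for an invariant measure. -/
lemma sum_toReal_measure_cyl_append {μ : Measure (X A)} [IsFiniteMeasure μ]
    (hμ : MeasurePreserving (shift A) μ μ) {n m : ℕ} (v : Fin m → A) :
    ∑ u : Fin n → A, (μ (cyl A (Fin.append u v))).toReal = (μ (cyl A v)).toReal := by
  rw [← (hμ.iterate n).measure_preimage (measurableSet_cyl A v).nullMeasurableSet,
    ← sum_toReal_measure_inter_cyl A μ n]
  refine Finset.sum_congr rfl fun u _ => ?_
  congr 2
  ext x
  simp only [cyl, mem_ofPred_eq, mem_inter_iff, mem_preimage, iterate_shift_apply]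
  constructor
  · intro hx
    exact ⟨fun i => by simpa using hx (Fin.natAdd n i), fun i => by simpa using hx (Fin.castAdd m i)⟩
  · rintro ⟨h1, h2⟩ i
    refine Fin.addCases (fun i => ?_) (fun i => ?_) i
    · simpa using h2 i
    · simpa using h1 i

/-! ### Return times -/

lemma retTime_spec {n : ℕ} {x : X A} (h : retTime A n x ≠ 0) :
    2 ≤ retTime A n x ∧ ∀ i < n, x (retTime A n x - 1 + i) = x i :=
  Nat.sInf_mem (Nat.nonempty_of_pos_sInf (Nat.pos_of_ne_zero h))

lemma retTime_le {n k : ℕ} {x : X A} (hk : 2 ≤ k) (h : ∀ i < n, x (k - 1 + i) = x i) :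
    retTime A n x ≤ k :=
  Nat.sInf_le ⟨hk, h⟩

lemma retTime_pos {n k : ℕ} {x : X A} (hk : 2 ≤ k) (h : ∀ i < n, x (k - 1 + i) = x i) :
    0 < retTime A n x := by
  have : retTime A n x ∈ {k | 2 ≤ k ∧ ∀ i < n, x (k - 1 + i) = x i} := Nat.sInf_mem ⟨k, hk, h⟩
  exact zero_lt_two.trans_le this.1

lemma measurable_retTime (n : ℕ) : Measurable (retTime A n) := by
  have hP : ∀ k, MeasurableSet {x : X A | 2 ≤ k ∧ ∀ i < n, x (k - 1 + i) = x i} := by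
    intro k
    refine (MeasurableSet.const _).inter ?_
    have : {x : X A | ∀ i < n, x (k - 1 + i) = x i}
        = ⋂ i, ⋂ _ : i < n, {x : X A | x (k - 1 + i) = x i} := by
      ext x
      simp
    change MeasurableSet {x : X A | ∀ i < n, x (k - 1 + i) = x i}
    rw [this]
    exact MeasurableSet.iInter fun i => MeasurableSet.iInter fun _ =>
      measurableSet_eq_fun (measurable_pi_apply _) (measurable_pi_apply _)
  refine measurable_of_Iic fun k => ?_
  have : retTime A n ⁻¹' Iic k =
      (⋃ j, {x : X A | 2 ≤ j ∧ ∀ i < n, x (j - 1 + i) = x i})ᶜ ∪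
        ⋃ j ∈ Iic k, {x : X A | 2 ≤ j ∧ ∀ i < n, x (j - 1 + i) = x i} := by
    ext x
    simp only [mem_preimage, mem_Iic, mem_union, mem_compl_iff, mem_iUnion, mem_ofPred_eq,
      exists_prop]
    constructor
    · intro hx
      by_cases h0 : retTime A n x = 0
      · refine Or.inl ?_
        rintro ⟨j, hj, h⟩
        exact (retTime_pos A hj h).ne' h0
      · exact Or.inr ⟨_, hx, retTime_spec A h0⟩
    · rintro (h | ⟨j, hj, h2, h⟩)
      · have h0 : retTime A n x = 0 := by
          by_contra h0
          exact h ⟨_, retTime_spec A h0⟩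
        omega
      · exact (retTime_le A h2 h).trans hj
  rw [this]
  exact (MeasurableSet.iUnion hP).compl.union
    (MeasurableSet.biUnion (to_countable _) fun j _ => hP j)

/-- Poincaré recurrence: almost every point returns. -/
lemma ae_retTime_ne_zero {μ : Measure (X A)} [IsFiniteMeasure μ]
    (hμ : MeasurePreserving (shift A) μ μ) (n : ℕ) : ∀ᵐ x ∂μ, retTime A n x ≠ 0 := by
  have hrec : ∀ᵐ x ∂μ, ∀ w : Fin n → A, x ∈ cyl A w →
      ∃ᶠ k in atTop, (shift A)^[k] x ∈ cyl A w :=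
    ae_all_iff.2 fun w => hμ.conservative.ae_mem_imp_frequently_image_mem
      (measurableSet_cyl A w).nullMeasurableSet
  filter_upwards [hrec] with x hx
  obtain ⟨k, hk1, hk⟩ := frequently_atTop.1 (hx (fun i => x i) fun i => rfl) 1
  refine (retTime_pos A (k := k + 1) (by omega) fun i hi => ?_).ne'
  have := hk ⟨i, hi⟩
  simpa [iterate_shift_apply] using this

/-- The return time if it is seen within the first `n + m` letters, and `0` otherwise. -/
noncomputable def truncTime (n m : ℕ) (x : X A) : ℕ :=
  if retTime A n x ≤ m + 1 then retTime A n x else 0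

lemma truncTime_spec {n m : ℕ} {x : X A} (h : truncTime A n m x ≠ 0) :
    truncTime A n m x = retTime A n x ∧ retTime A n x ≠ 0 ∧ retTime A n x ≤ m + 1 := by
  unfold truncTime at h ⊢
  split_ifs at h ⊢ with h1
  · exact ⟨rfl, h, h1⟩
  · exact absurd rfl h

lemma truncTime_congr {n m : ℕ} {x y : X A} (hxy : ∀ i < n + m, x i = y i) :
    truncTime A n m x = truncTime A n m y := by
  have key : ∀ x y : X A, (∀ i < n + m, x i = y i) → truncTime A n m x ≠ 0 →
      retTime A n y ≠ 0 ∧ retTime A n y ≤ truncTime A n m x := by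
    intro x y hxy h
    obtain ⟨h1, h2, h3⟩ := truncTime_spec A h
    obtain ⟨h4, h5⟩ := retTime_spec A h2
    have : ∀ i < n, y (retTime A n x - 1 + i) = y i := fun i hi => by
      rw [← hxy i (by omega), ← hxy _ (by omega), h5 i hi]
    rw [h1]
    exact ⟨(retTime_pos A h4 this).ne', retTime_le A h4 this⟩
  have key2 : ∀ x y : X A, (∀ i < n + m, x i = y i) → truncTime A n m x ≠ 0 →
      truncTime A n m y ≠ 0 ∧ truncTime A n m y ≤ truncTime A n m x := by
    intro x y hxy h
    obtain ⟨h1, h2⟩ := key x y hxy h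
    obtain ⟨h3, h4, h5⟩ := truncTime_spec A h
    have : truncTime A n m y = retTime A n y := if_pos (by omega)
    rw [this]
    exact ⟨h1, h2⟩
  have hyx : ∀ i < n + m, y i = x i := fun i hi => (hxy i hi).symm
  by_cases hx : truncTime A n m x = 0
  · by_cases hy : truncTime A n m y = 0
    · rw [hx, hy]
    · exact absurd hx (key2 y x hyx hy).1
  · obtain ⟨h1, h2⟩ := key2 x y hxy hx
    exact le_antisymm (key2 y x hyx h1).2 h2

/-- The first `n` letters can be decoded from the return time and the `m` letters that follow. -/
lemma eq_of_truncTime_eq {n m : ℕ} {x y : X A} (hxy : ∀ i, n ≤ i → i < n + m → x i = y i)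
    (hT : truncTime A n m x = truncTime A n m y) (h0 : truncTime A n m x ≠ 0) :
    ∀ i < n + m, x i = y i := by
  obtain ⟨hx1, hx2, hx3⟩ := truncTime_spec A h0
  obtain ⟨hy1, hy2, hy3⟩ := truncTime_spec A (hT ▸ h0)
  obtain ⟨h2, hxk⟩ := retTime_spec A hx2
  have hyk := (retTime_spec A hy2).2
  rw [← hy1, ← hT, hx1] at hyk
  have : ∀ d i, i < n + m → n + m - i ≤ d → x i = y i := by
    intro d
    induction d with
    | zero => intro i hi hd; omega
    | succ d ih =>
      intro i hi hd
      by_cases hin : n ≤ i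
      · exact hxy i hin hi
      · rw [← hxk i (by omega), ← hyk i (by omega)]
        exact ih _ (by omega) (by omega)
  exact fun i hi => this _ i hi le_rfl

/-- Some sequence starting with the word `w`. -/
noncomputable def extend [Nonempty A] {N : ℕ} (w : Fin N → A) : X A :=
  fun j => if h : j < N then w ⟨j, h⟩ else Classical.arbitrary A

lemma eq_extend_of_mem_cyl [Nonempty A] {N : ℕ} {w : Fin N → A} {x : X A} (hx : x ∈ cyl A w) :
    ∀ i < N, x i = extend A w i := by
  intro i hi
  simp only [extend, hi, dite_true]
  exact hx ⟨i, hi⟩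

/-- The value of the truncated return time on the cylinder of a word of length `n + m`. -/
noncomputable def wordTime [Nonempty A] (n m : ℕ) (w : Fin (n + m) → A) : ℕ :=
  truncTime A n m (extend A w)

lemma truncTime_eq_wordTime [Nonempty A] {n m : ℕ} {w : Fin (n + m) → A} {x : X A}
    (hx : x ∈ cyl A w) : truncTime A n m x = wordTime A n m w :=
  truncTime_congr A (eq_extend_of_mem_cyl A hx)

lemma append_left_injOn_wordTime [Nonempty A] {n m : ℕ} {v : Fin m → A} {u u' : Fin n → A}
    (hT : wordTime A n m (Fin.append u v) = wordTime A n m (Fin.append u' v))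
    (h0 : wordTime A n m (Fin.append u v) ≠ 0) : u = u' := by
  have hval : ∀ (u : Fin n → A) i (h : i < n + m),
      extend A (Fin.append u v) i = Fin.append u v ⟨i, h⟩ := fun u i h => by simp [extend, h]
  have := eq_of_truncTime_eq A (fun i hi hi' => ?_) hT h0
  · funext i
    have hi := this i (by omega)
    rw [hval _ _ (by omega), hval _ _ (by omega)] at hi
    simpa using (Fin.append_left u v i).symm.trans (Eq.trans hi (Fin.append_left u' v i))
  · obtain ⟨j, rfl⟩ := Nat.exists_eq_add_of_le hi
    rw [hval _ _ hi', hval _ _ hi']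
    exact (Fin.append_right u v ⟨j, by omega⟩).trans (Fin.append_right u' v ⟨j, by omega⟩).symm

lemma tendsto_measure_truncTime_eq_zero {μ : Measure (X A)} [IsFiniteMeasure μ]
    (hμ : MeasurePreserving (shift A) μ μ) (n : ℕ) :
    Tendsto (fun m => (μ {x | truncTime A n m x = 0}).toReal) atTop (𝓝 0) := by
  have hset : ∀ m, {x | truncTime A n m x = 0}
      = retTime A n ⁻¹' {k | k = 0 ∨ m + 1 < k} := by
    intro m
    ext x
    simp only [truncTime, mem_ofPred_eq, mem_preimage]
    split_ifs <;> omega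
  have hlim := tendsto_measure_iInter_atTop (μ := μ) (s := fun m => {x | truncTime A n m x = 0})
    (fun m => by
      rw [hset]
      exact (measurable_retTime A n (MeasurableSet.of_discrete)).nullMeasurableSet)
    (fun m m' hm x => by
      simp only [hset, mem_ofPred_eq, mem_preimage]
      omega)
    ⟨0, measure_ne_top _ _⟩
  have hzero : μ (⋂ m, {x | truncTime A n m x = 0}) = 0 := by
    refine measure_mono_null (fun x hx => ?_) (ae_iff.1 (ae_retTime_ne_zero A hμ n))
    simp only [mem_iInter, hset, mem_ofPred_eq, mem_preimage] at hx
    have := hx (retTime A n x)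
    simp only [mem_ofPred_eq, not_not]
    omega
  rw [hzero] at hlim
  simpa [Function.comp_def] using (ENNReal.tendsto_toReal ENNReal.zero_ne_top).comp hlim

/-- The unnormalized entropy of the first `N` letters. -/
noncomputable def blockEntropy (μ : Measure (X A)) (N : ℕ) : ℝ :=
  -∑ w : Fin N → A, (μ (cyl A w)).toReal * Real.log (μ (cyl A w)).toReal

lemma entSeq_eq_blockEntropy_div (μ : Measure (X A)) (N : ℕ) :
    entSeq A μ N = blockEntropy A μ N / N := by
  simp only [entSeq, blockEntropy]
  ring

/-- Coding the first `n` of `n + m` letters by their return time bounds the conditional entropy. -/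
lemma blockEntropy_increment_le [Nonempty A] {μ : Measure (X A)} [IsProbabilityMeasure μ]
    (hμ : MeasurePreserving (shift A) μ μ) {δ : ℝ} (hδ : 0 < δ) (n m : ℕ) :
    blockEntropy A μ (n + m) - blockEntropy A μ m ≤
      Real.log (1 + ∑' k : ℕ, (k : ℝ) ^ (-(1 + δ)))
      + (1 + δ) * ∑ w : Fin (n + m) → A, (μ (cyl A w)).toReal * Real.log (wordTime A n m w)
      + n * Real.log (Fintype.card A) * (μ {x | truncTime A n m x = 0}).toReal := by
  set Z : ℝ := ∑' k : ℕ, (k : ℝ) ^ (-(1 + δ))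
  have hsummable : Summable fun k : ℕ => (k : ℝ) ^ (-(1 + δ)) :=
    Real.summable_nat_rpow.2 (by linarith)
  have hZ0 : 0 ≤ Z := tsum_nonneg fun k => by positivity
  have hcard : (0 : ℝ) < Fintype.card A := by exact_mod_cast Fintype.card_pos
  let Q : (Fin (n + m) → A) → ℝ := fun w =>
    if wordTime A n m w = 0 then (1 + Z)⁻¹ * ((Fintype.card A : ℝ) ^ n)⁻¹
    else (1 + Z)⁻¹ * (wordTime A n m w : ℝ) ^ (-(1 + δ))
  have hQpos : ∀ w, 0 < Q w := by
    intro w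
    simp only [Q]
    split_ifs with h
    · positivity
    · have : (0 : ℝ) < wordTime A n m w := by exact_mod_cast Nat.pos_of_ne_zero h
      positivity
  have hlogQ : ∀ w, -Real.log (Q w) = Real.log (1 + Z)
      + (1 + δ) * Real.log (wordTime A n m w)
      + n * Real.log (Fintype.card A) * (if wordTime A n m w = 0 then 1 else 0) := by
    intro w
    simp only [Q]
    split_ifs with h
    · rw [Real.log_mul (by positivity) (by positivity), Real.log_inv, Real.log_inv, Real.log_pow, h]
      simp
      ring
    · have : (0 : ℝ) < wordTime A n m w := by exact_mod_cast Nat.pos_of_ne_zero h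
      rw [Real.log_mul (by positivity) (by positivity), Real.log_inv, Real.log_rpow this]
      ring
  have hQsum : ∀ v : Fin m → A, ∑ u : Fin n → A, Q (Fin.append u v) ≤ 1 := by
    intro v
    have hle : ∀ u : Fin n → A, Q (Fin.append u v) ≤ (1 + Z)⁻¹ * ((Fintype.card A : ℝ) ^ n)⁻¹
        + (1 + Z)⁻¹ * (if wordTime A n m (Fin.append u v) = 0 then 0
          else (wordTime A n m (Fin.append u v) : ℝ) ^ (-(1 + δ))) := by
      intro u
      simp only [Q]
      split_ifs with h
      · simp
      · exact le_add_of_nonneg_left (by positivity)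
    have hinj : ∑ u : Fin n → A, (if wordTime A n m (Fin.append u v) = 0 then 0
        else (wordTime A n m (Fin.append u v) : ℝ) ^ (-(1 + δ))) ≤ Z := by
      rw [Finset.sum_ite, Finset.sum_const_zero, zero_add,
        ← Finset.sum_image (f := fun k : ℕ => (k : ℝ) ^ (-(1 + δ)))
        (g := fun u : Fin n → A => wordTime A n m (Fin.append u v))]
      · exact hsummable.sum_le_tsum _ fun k _ => by positivity
      · intro u hu u' _ huu'
        exact append_left_injOn_wordTime A huu' (by simpa using hu)
    refine (Finset.sum_le_sum fun u _ => hle u).trans ?_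
    have h1 : ∑ _u : Fin n → A, (1 + Z)⁻¹ * ((Fintype.card A : ℝ) ^ n)⁻¹ = (1 + Z)⁻¹ := by
      simp only [Finset.sum_const, Finset.card_univ, Fintype.card_fun, Fintype.card_fin,
        nsmul_eq_mul, Nat.cast_pow]
      field_simp
    rw [Finset.sum_add_distrib, h1, ← Finset.mul_sum]
    have h2 := mul_le_mul_of_nonneg_left hinj (inv_nonneg.2 (by linarith : 0 ≤ 1 + Z))
    have h3 : (1 + Z)⁻¹ + (1 + Z)⁻¹ * Z = 1 := by field_simp
    linarith
  have hgibbs := condEntropy_le_codeLength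
    (fun (u : Fin n → A) (v : Fin m → A) => (μ (cyl A (Fin.append u v))).toReal)
    (fun u v => Q (Fin.append u v)) (fun _ _ => ENNReal.toReal_nonneg) (fun _ _ => hQpos _) hQsum
  simp only [sum_toReal_measure_cyl_append A hμ] at hgibbs
  have hsplit : ∀ f : (Fin (n + m) → A) → ℝ,
      ∑ v : Fin m → A, ∑ u : Fin n → A, f (Fin.append u v) = ∑ w, f w := by
    intro f
    rw [Finset.sum_comm, ← Fintype.sum_prod_type' (fun u v => f (Fin.append u v))]
    exact (Fin.appendEquiv n m).sum_comp f
  rw [hsplit fun w => (μ (cyl A w)).toReal * Real.log (μ (cyl A w)).toReal,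
    hsplit fun w => (μ (cyl A w)).toReal * -Real.log (Q w)] at hgibbs
  have hfail : ∑ w : Fin (n + m) → A, (μ (cyl A w)).toReal *
      (if wordTime A n m w = 0 then 1 else 0) = (μ {x | truncTime A n m x = 0}).toReal := by
    rw [← sum_toReal_measure_inter_cyl A μ (n + m)]
    refine Finset.sum_congr rfl fun w _ => ?_
    split_ifs with h
    · have : cyl A w ⊆ {x | truncTime A n m x = 0} :=
        fun x hx => (truncTime_eq_wordTime A hx).trans h
      rw [mul_one, inter_eq_right.2 this]
    · have : {x | truncTime A n m x = 0} ∩ cyl A w = ∅ :=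
        eq_empty_of_forall_notMem fun x hx => h ((truncTime_eq_wordTime A hx.2).symm.trans hx.1)
      simp [this]
  have hcode : ∑ w : Fin (n + m) → A, (μ (cyl A w)).toReal * -Real.log (Q w)
      = Real.log (1 + Z)
      + (1 + δ) * ∑ w : Fin (n + m) → A, (μ (cyl A w)).toReal * Real.log (wordTime A n m w)
      + n * Real.log (Fintype.card A) * (μ {x | truncTime A n m x = 0}).toReal := by
    have hconst : Real.log (1 + Z)
        = ∑ w : Fin (n + m) → A, (μ (cyl A w)).toReal * Real.log (1 + Z) := by
      rw [← Finset.sum_mul, sum_toReal_measure_cyl, one_mul]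
    rw [← hfail, Finset.mul_sum, Finset.mul_sum, hconst, ← Finset.sum_add_distrib,
      ← Finset.sum_add_distrib]
    refine Finset.sum_congr rfl fun w _ => ?_
    rw [hlogQ]
    ring
  simp only [blockEntropy]
  linarith

/-- Jensen's inequality for `R_n ^ q`, `q ≥ 0`, along the truncated return times. -/
lemma exp_le_lintegral_retTime_rpow [Nonempty A] {μ : Measure (X A)} [IsProbabilityMeasure μ]
    (hμ : MeasurePreserving (shift A) μ μ) {q : ℝ} (hq : 0 ≤ q) (n m : ℕ) :
    ENNReal.ofReal (Real.exp
      (q * ∑ w : Fin (n + m) → A, (μ (cyl A w)).toReal * Real.log (wordTime A n m w)))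
      ≤ ∫⁻ x, ENNReal.ofReal ((retTime A n x : ℝ) ^ q) ∂μ := by
  have hjensen := exp_sum_le_sum_exp (fun w : Fin (n + m) → A => (μ (cyl A w)).toReal)
    (fun w => q * Real.log (wordTime A n m w)) (fun _ => ENNReal.toReal_nonneg)
    (sum_toReal_measure_cyl A μ (n + m))
  rw [Finset.mul_sum]
  simp only [mul_left_comm q]
  refine (ENNReal.ofReal_le_ofReal hjensen).trans ?_
  rw [ENNReal.ofReal_sum_of_nonneg fun _ _ => by positivity,
    ← sum_setLIntegral_cyl A μ (n + m)]
  refine Finset.sum_le_sum fun w _ => ?_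
  rw [mul_comm, ENNReal.ofReal_mul (Real.exp_pos _).le, ENNReal.ofReal_toReal (measure_ne_top _ _),
    ← setLIntegral_const]
  refine lintegral_mono_ae ?_
  filter_upwards [ae_restrict_mem (measurableSet_cyl A w),
    ae_restrict_of_ae (ae_retTime_ne_zero A hμ n)] with x hx hx0
  refine ENNReal.ofReal_le_ofReal ?_
  have hR : (1 : ℝ) ≤ retTime A n x := by exact_mod_cast Nat.one_le_iff_ne_zero.2 hx0
  rw [← truncTime_eq_wordTime A hx]
  by_cases h0 : truncTime A n m x = 0
  · simpa [h0] using Real.one_le_rpow hR hq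
  · rw [(truncTime_spec A h0).1, Real.rpow_def_of_pos (by linarith), mul_comm]

/-- Kac's inequality on a cylinder; the extra `μ [w]` comes from `R_n` being the return time
plus one. -/
lemma setLIntegral_retTime_le {μ : Measure (X A)} [IsProbabilityMeasure μ]
    (hμ : MeasurePreserving (shift A) μ μ) {n : ℕ} (w : Fin n → A) :
    ∫⁻ x in cyl A w, (retTime A n x : ENNReal) ∂μ ≤ μ (cyl A w) + 1 := by
  let B : ℕ → Set (X A) := fun k => {x | ∀ i < k, (shift A)^[i] x ∉ cyl A w}
  have hB : ∀ k, MeasurableSet (B k) := by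
    intro k
    have : B k = ⋂ i, ⋂ _ : i < k, ((shift A)^[i] ⁻¹' cyl A w)ᶜ := by
      ext x
      simp [B]
    rw [this]
    exact MeasurableSet.iInter fun i => MeasurableSet.iInter fun _ =>
      ((measurable_shift A).iterate i (measurableSet_cyl A w)).compl
  have hstep : ∀ k, μ (shift A ⁻¹' B k ∩ cyl A w) + μ (B (k + 1)) = μ (B k) := by
    intro k
    have hdiff : B (k + 1) = shift A ⁻¹' B k \ cyl A w := by
      ext x
      simp only [B, mem_ofPred_eq, Set.mem_sdiff, mem_preimage]
      constructor
      · intro hx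
        exact ⟨fun i hi => hx (i + 1) (by omega), hx 0 (by omega)⟩
      · rintro ⟨h1, h2⟩ i hi
        cases i with
        | zero => exact h2
        | succ i => exact h1 i (by omega)
    rw [hdiff, measure_inter_add_sdiff _ (measurableSet_cyl A w),
      hμ.measure_preimage (hB k).nullMeasurableSet]
  have hpartial : ∀ K, ∑ k ∈ Finset.range K, μ (shift A ⁻¹' B k ∩ cyl A w) + μ (B K) = μ (B 0) := by
    intro K
    induction K with
    | zero => simp
    | succ K ih => rw [Finset.sum_range_succ, add_assoc, hstep, ih]
  have htsum : ∑' k, μ (shift A ⁻¹' B k ∩ cyl A w) ≤ 1 :=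
    ENNReal.tsum_le_of_sum_range_le fun K =>
      (le_self_add.trans (hpartial K).le).trans prob_le_one
  have hlevel : ∀ k, MeasurableSet {x | k < retTime A n x} := fun k =>
    measurable_retTime A n (MeasurableSet.of_discrete (s := {r | k < r}))
  have hlayer : ∀ x, (retTime A n x : ENNReal)
      = ∑' k, {x | k < retTime A n x}.indicator (fun _ => (1 : ENNReal)) x := by
    intro x
    rw [tsum_eq_sum (s := Finset.range (retTime A n x)) fun k hk => by
      simpa [indicator_apply] using hk]
    rw [Finset.sum_congr rfl fun k hk => indicator_of_mem (by simpa using hk) _]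
    simp
  simp only [hlayer]
  rw [lintegral_tsum fun k => (measurable_const.indicator (hlevel k)).aemeasurable]
  simp only [lintegral_indicator_const (hlevel _), one_mul, Measure.restrict_apply (hlevel _)]
  rw [tsum_eq_zero_add' ENNReal.summable]
  refine add_le_add (measure_mono inter_subset_right)
    ((ENNReal.tsum_le_tsum fun k => measure_mono ?_).trans htsum)
  rintro x ⟨hk, hx⟩
  refine ⟨fun i hi hcyl => ?_, hx⟩
  have hret : ∀ j < n, x (i + 2 - 1 + j) = x j := by
    intro j hj
    have h1 := hcyl ⟨j, hj⟩
    rw [← Function.iterate_succ_apply, iterate_shift_apply] at h1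
    exact h1.trans (hx ⟨j, hj⟩).symm
  have := retTime_le A (by omega) hret
  simp only [mem_ofPred_eq] at hk
  omega

lemma ofReal_le_setLIntegral_retTime_rpow {μ : Measure (X A)} [IsProbabilityMeasure μ]
    (hμ : MeasurePreserving (shift A) μ μ) {q : ℝ} (hq : q ≤ 0) {n : ℕ} (w : Fin n → A) :
    ENNReal.ofReal ((μ (cyl A w)).toReal
      * Real.exp (q * (Real.log 2 - Real.log (μ (cyl A w)).toReal)))
      ≤ ∫⁻ x in cyl A w, ENNReal.ofReal ((retTime A n x : ℝ) ^ q) ∂μ := by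
  set p := (μ (cyl A w)).toReal
  have hp1 : p ≤ 1 := ENNReal.toReal_le_of_le_ofReal zero_le_one (by simpa using prob_le_one)
  have hμp : μ (cyl A w) = ENNReal.ofReal p := (ENNReal.ofReal_toReal (measure_ne_top _ _)).symm
  rcases (ENNReal.toReal_nonneg : 0 ≤ p).eq_or_lt with h0 | h0
  · have hp0 : p = 0 := h0.symm
    simp [hp0]
  set C := 2 / p with hCdef
  have hC : 0 < C := by positivity
  have hCq : Real.exp (q * (Real.log 2 - Real.log p)) = C ^ q := by
    rw [Real.rpow_def_of_pos hC, hCdef, Real.log_div two_ne_zero h0.ne', mul_comm]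
  have hCqpos : 0 < C ^ q := Real.rpow_pos_of_pos hC q
  have hcoef : 0 ≤ -q * C ^ q / C := by
    have : 0 ≤ -q := by linarith
    positivity
  have hkac : ∫⁻ x in cyl A w, (retTime A n x : ENNReal) ∂μ ≤ ENNReal.ofReal (C * p) := by
    refine (setLIntegral_retTime_le A hμ w).trans ?_
    rw [hμp, ← ENNReal.ofReal_one, ← ENNReal.ofReal_add h0.le zero_le_one]
    refine ENNReal.ofReal_le_ofReal ?_
    rw [hCdef, div_mul_cancel₀ _ h0.ne']
    linarith
  have hmeas : Measurable fun x => ENNReal.ofReal (-q * C ^ q / C) * (retTime A n x : ENNReal) :=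
    ((measurable_from_nat (f := fun k : ℕ => (k : ENNReal))).comp
      (measurable_retTime A n)).const_mul _
  have hint : ENNReal.ofReal ((1 - q) * C ^ q) * ENNReal.ofReal p
      ≤ ∫⁻ x in cyl A w, ENNReal.ofReal ((retTime A n x : ℝ) ^ q) ∂μ
        + ENNReal.ofReal (-q * C ^ q / C) * ENNReal.ofReal (C * p) := by
    rw [← hμp, ← setLIntegral_const]
    refine (lintegral_mono_ae ?_).trans ((lintegral_add_right _ hmeas).le.trans
      (add_le_add_right ?_ _))
    · filter_upwards [ae_restrict_of_ae (ae_retTime_ne_zero A hμ n)] with x hx0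
      have hR : (0 : ℝ) < retTime A n x := by exact_mod_cast Nat.pos_of_ne_zero hx0
      rw [← ENNReal.ofReal_natCast, ← ENNReal.ofReal_mul hcoef,
        ← ENNReal.ofReal_add (by positivity) (mul_nonneg hcoef hR.le)]
      exact ENNReal.ofReal_le_ofReal (rpow_tangent_le hq hC hR)
    · rw [lintegral_const_mul' _ _ ENNReal.ofReal_ne_top]
      exact mul_le_mul_right hkac _
  rw [← ENNReal.ofReal_mul (mul_nonneg (by linarith) hCqpos.le), ← ENNReal.ofReal_mul hcoef,
    show (1 - q) * C ^ q * p = p * C ^ q + -q * C ^ q / C * (C * p) by field_simp; ring,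
    ENNReal.ofReal_add (by positivity) (mul_nonneg hcoef (by positivity))] at hint
  rw [hCq]
  exact (ENNReal.add_le_add_iff_right ENNReal.ofReal_ne_top).1 hint

lemma exp_blockEntropy_le_lintegral {μ : Measure (X A)} [IsProbabilityMeasure μ]
    (hμ : MeasurePreserving (shift A) μ μ) {q : ℝ} (hq : q ≤ 0) (n : ℕ) :
    ENNReal.ofReal (Real.exp (q * (Real.log 2 + blockEntropy A μ n)))
      ≤ ∫⁻ x, ENNReal.ofReal ((retTime A n x : ℝ) ^ q) ∂μ := by
  have hjensen := exp_sum_le_sum_exp (fun w : Fin n → A => (μ (cyl A w)).toReal)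
    (fun w => q * (Real.log 2 - Real.log (μ (cyl A w)).toReal))
    (fun _ => ENNReal.toReal_nonneg) (sum_toReal_measure_cyl A μ n)
  have hexp : ∑ w : Fin n → A, (μ (cyl A w)).toReal
      * (q * (Real.log 2 - Real.log (μ (cyl A w)).toReal))
      = q * (Real.log 2 + blockEntropy A μ n) := by
    simp only [mul_left_comm _ q, mul_sub, ← Finset.mul_sum, Finset.sum_sub_distrib,
      ← Finset.sum_mul, sum_toReal_measure_cyl, blockEntropy]
    ring
  rw [← hexp]
  refine (ENNReal.ofReal_le_ofReal hjensen).trans ?_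
  rw [ENNReal.ofReal_sum_of_nonneg fun _ _ => by positivity, ← sum_setLIntegral_cyl A μ n]
  exact Finset.sum_le_sum fun w _ => ofReal_le_setLIntegral_retTime_rpow A hμ hq w

lemma coe_div_le_RSeq {μ : Measure (X A)} {q t : ℝ} {n : ℕ}
    (ht : ENNReal.ofReal (Real.exp t) ≤ ∫⁻ x, ENNReal.ofReal ((retTime A n x : ℝ) ^ q) ∂μ) :
    ((t / n : ℝ) : EReal) ≤ RSeq A μ q n := by
  have hlog := ENNReal.log_le_log ht
  rw [ENNReal.log_ofReal_of_pos (Real.exp_pos t), Real.log_exp] at hlog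
  rw [div_eq_inv_mul, EReal.coe_mul]
  exact mul_le_mul_of_nonneg_left hlog (EReal.coe_nonneg.2 (by positivity))

lemma le_liminf_of_tendsto_of_le {f : ℕ → ℝ} {g : ℕ → EReal} {l : ℝ}
    (hf : Tendsto f atTop (𝓝 l)) (hfg : ∀ᶠ n in atTop, (f n : EReal) ≤ g n) :
    (l : EReal) ≤ atTop.liminf g := by
  rw [← ((continuous_coe_real_ereal.tendsto l).comp hf).liminf_eq]
  exact liminf_le_liminf hfg

lemma le_liminf_RSeq_of_nonneg [Nonempty A] {μ : Measure (X A)} [IsProbabilityMeasure μ]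
    (hμ : MeasurePreserving (shift A) μ μ) {q h δ : ℝ} (hq : 0 ≤ q) (hδ : 0 < δ)
    (hent : Tendsto (entSeq A μ) atTop (𝓝 h)) :
    ((q * ((h - δ) / (1 + δ)) : ℝ) : EReal) ≤ atTop.liminf (RSeq A μ q) := by
  set C := Real.log (1 + ∑' k : ℕ, (k : ℝ) ^ (-(1 + δ))) + 1
  have hlim : Tendsto (fun n : ℕ => q * ((h - δ - C / n) / (1 + δ))) atTop
      (𝓝 (q * ((h - δ) / (1 + δ)))) := by
    have := (tendsto_const_div_atTop_nhds_zero_nat C).const_sub (h - δ)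
    rw [sub_zero] at this
    exact (this.div_const _).const_mul q
  refine le_liminf_of_tendsto_of_le hlim ?_
  filter_upwards [eventually_ge_atTop 1] with n hn
  have hn0 : (0 : ℝ) < n := by exact_mod_cast hn
  have hfail := (tendsto_measure_truncTime_eq_zero A hμ n).const_mul (n * Real.log (Fintype.card A))
  rw [mul_zero] at hfail
  obtain ⟨M, hM⟩ := eventually_atTop.1 (hfail.eventually_le_const zero_lt_one)
  obtain ⟨m, hm, hinc⟩ := exists_increment_ge
    (hent.congr (entSeq_eq_blockEntropy_div A μ)) hδ hn M
  have hcode := blockEntropy_increment_le A hμ hδ n m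
  have hlower : (n * (h - δ) - C) / (1 + δ)
      ≤ ∑ w : Fin (n + m) → A, (μ (cyl A w)).toReal * Real.log (wordTime A n m w) := by
    rw [div_le_iff₀ (by linarith)]
    have := hM m hm
    simp only [C]
    linarith
  have hbound := (ENNReal.ofReal_le_ofReal (Real.exp_le_exp.2
    (mul_le_mul_of_nonneg_left hlower hq))).trans (exp_le_lintegral_retTime_rpow A hμ hq n m)
  convert coe_div_le_RSeq A hbound using 2
  field_simp

/-- for an ergodic shift-invariant probability measure `μ`,
`q·h(μ) ≤ liminf_n (1/n) log ∫ R_n^q dμ` for every `q ∈ ℝ`. -/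
theorem return_time_spectrum_entropy_lower_bound
    (hcard : 1 < Fintype.card A)
    (μ : Measure (X A)) [IsProbabilityMeasure μ] (herg : Ergodic (shift A) μ)
    (q : ℝ) (h : ℝ) (hent : Tendsto (entSeq A μ) atTop (nhds h)) :
    ((q * h : ℝ) : EReal) ≤ atTop.liminf (RSeq A μ q) := by
  have : Nonempty A := Fintype.card_pos_iff.1 (by omega)
  have hμ := herg.toMeasurePreserving
  rcases le_total 0 q with hq | hq
  · have hlim : Tendsto (fun δ : ℝ => ((q * ((h - δ) / (1 + δ)) : ℝ) : EReal)) (𝓝[>] 0)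
        (𝓝 ((q * h : ℝ) : EReal)) := by
      refine (continuous_coe_real_ereal.tendsto _).comp (tendsto_nhdsWithin_of_tendsto_nhds ?_)
      have hcont : ContinuousAt (fun δ : ℝ => q * ((h - δ) / (1 + δ))) 0 := by
        fun_prop (disch := norm_num)
      simpa using hcont.tendsto
    refine le_of_tendsto hlim ?_
    filter_upwards [self_mem_nhdsWithin] with δ hδ
    exact le_liminf_RSeq_of_nonneg A hμ hq hδ hent
  · have hlim : Tendsto (fun n : ℕ => q * (Real.log 2 / n + entSeq A μ n)) atTop (𝓝 (q * h)) := by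
      have := (tendsto_const_div_atTop_nhds_zero_nat (Real.log 2)).add hent
      rw [zero_add] at this
      exact this.const_mul q
    refine le_liminf_of_tendsto_of_le hlim (Eventually.of_forall fun n => ?_)
    convert coe_div_le_RSeq A (exp_blockEntropy_le_lintegral A hμ hq n) using 2
    rw [entSeq_eq_blockEntropy_div]
    ring

end RTSpec
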